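/- Let N be a positive integer, H a finite-dimensional complex inner product space, U a unitary representation of ZMod N on H with spectral projections P, and suppose the Hamiltonian is non-degenerate, i.e. every P_E has rank at most 1. Then the following are equivalent: (i) there exist a positive integer d dividing N and an orthonormal basis b indexed by ZMod d of H such that U(t)(b(x)) = b(x + t̄) for all t : ZMod N and x : ZMod d, where t̄ denotes the image of t under the natural ring homomorphism ZMod N → ZMod d (an internal time observable exists); (ii) the spectrum {E : ZMod N | P_E ≠ 0} is the carrier of an additive subgroup of ZMod N. -/

import Mathlib

open scoped BigOperators InnerProductSpace

/-- The multiplicative characters (energy levels) of `ZMod N`. -/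
noncomputable def chi (N : ℕ) (E t : ZMod N) : ℂ :=
  Complex.exp (2 * Real.pi * Complex.I * (E.val * t.val) / N)

/-- The characters `chi N E` are dilates of the standard additive character. -/
lemma chi_eq_stdAddChar (N : ℕ) [NeZero N] (E t : ZMod N) :
    chi N E t = ZMod.stdAddChar (E * t) := by
  have h : E * t = (((E.val * t.val : ℕ) : ℤ) : ZMod N) := by
    push_cast
    simp
  rw [h, ZMod.stdAddChar_coe, chi]
  congr 1
  push_cast
  ring

lemma sum_stdAddChar_mul (N : ℕ) [NeZero N] (E : ZMod N) :
    ∑ t : ZMod N, ZMod.stdAddChar (E * t) = if E = 0 then (N : ℂ) else 0 := by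
  have h := AddChar.sum_mulShift E (ZMod.isPrimitive_stdAddChar N)
  simpa [mul_comm, ZMod.card] using h

/-- Fourier inversion for a spectral resolution over `ZMod N`. -/
lemma sum_stdAddChar_smul_eq {N : ℕ} [NeZero N] {M : Type*} [AddCommGroup M] [Module ℂ M]
    {U P : ZMod N → M} (hUP : ∀ t, U t = ∑ E, chi N E t • P E) (E : ZMod N) :
    ∑ t, ZMod.stdAddChar (-(E * t)) • U t = (N : ℂ) • P E := by
  simp_rw [hUP, Finset.smul_sum, smul_smul, chi_eq_stdAddChar, ← AddChar.map_add_eq_mul]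
  rw [Finset.sum_comm]
  have h : ∀ F t : ZMod N, -(E * t) + F * t = (F - E) * t := fun F t ↦ by ring
  simp_rw [h, ← Finset.sum_smul, sum_stdAddChar_mul, sub_eq_zero, ite_smul, zero_smul]
  simp

/-- If a time basis indexed by `ZMod d` exists, the occupied levels are the `d`-torsion. -/
lemma ne_zero_iff_of_timeBasis {N : ℕ} [NeZero N] {H : Type*} [NormedAddCommGroup H]
    [InnerProductSpace ℂ H] {U P : ZMod N → (H →L[ℂ] H)}
    (hPidem : ∀ E, P E ∘L P E = P E) (hPorth : ∀ E E', E ≠ E' → P E ∘L P E' = 0)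
    (hUP : ∀ t, U t = ∑ E, chi N E t • P E)
    {d : ℕ} [NeZero d] (hdvd : d ∣ N) (b : OrthonormalBasis (ZMod d) ℂ H)
    (hb : ∀ t x, U t (b x) = b (x + ZMod.castHom hdvd (ZMod d) t)) (E : ZMod N) :
    P E ≠ 0 ↔ E * (d : ZMod N) = 0 := by
  constructor
  · intro hE
    have hd1 : U (d : ZMod N) = 1 := by
      ext v
      rw [← b.sum_repr v]
      simp [hb]
    have h1 : chi N E d • P E = P E := by
      have : U (d : ZMod N) ∘L P E = chi N E d • P E := by
        rw [hUP, ContinuousLinearMap.finsetSum_comp, Finset.sum_eq_single E]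
        · rw [ContinuousLinearMap.smul_comp, hPidem]
        · intro F _ hF
          rw [ContinuousLinearMap.smul_comp, hPorth F E hF, smul_zero]
        · simp
      rw [← this, hd1]
      rfl
    have h2 : chi N E d = 1 := by
      have : (chi N E d - 1) • P E = 0 := by rw [sub_smul, h1, one_smul, sub_self]
      simpa [sub_eq_zero, hE] using this
    rw [chi_eq_stdAddChar] at h2
    exact ZMod.injective_stdAddChar (h2.trans (AddChar.map_zero_eq_one _).symm)
  · intro hE hP
    have h := sum_stdAddChar_smul_eq hUP E
    rw [hP, smul_zero] at h
    have h2 := congrArg (fun T : H →L[ℂ] H ↦ ⟪b 0, T (b 0)⟫_ℂ) h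
    simp only [_root_.sum_apply, _root_.smul_apply, hb, zero_add,
      inner_sum, inner_smul_right, _root_.zero_apply, inner_zero_right,
      orthonormal_iff_ite.mp b.orthonormal] at h2
    have h3 : ∀ t : ZMod N,
        ZMod.stdAddChar (-(E * t)) * (if 0 = ZMod.castHom hdvd (ZMod d) t then (1 : ℂ) else 0)
          = (((if 0 = ZMod.castHom hdvd (ZMod d) t then 1 else 0 : ℕ)) : ℂ) := by
      intro t
      split_ifs with ht
      · have hv : ((t.val : ℕ) : ZMod d) = 0 := by
          rw [ht, ← map_natCast (ZMod.castHom hdvd (ZMod d)), ZMod.natCast_zmod_val]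
        obtain ⟨k, hk⟩ := (ZMod.natCast_eq_zero_iff _ _).mp hv
        have : E * t = 0 := by
          rw [← ZMod.natCast_zmod_val t, hk, Nat.cast_mul, ← mul_assoc, hE, zero_mul]
        simp [this]
      · simp
    rw [Finset.sum_congr rfl fun t _ ↦ h3 t, ← Nat.cast_sum, Nat.cast_eq_zero,
      Finset.sum_eq_zero_iff] at h2
    simpa using h2 0 (Finset.mem_univ _)

/-- Orthogonality of the characters of a subgroup `S` of `ZMod N`. -/
lemma sum_addSubgroup_stdAddChar (N : ℕ) [NeZero N] (S : AddSubgroup (ZMod N)) [Fintype S]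
    {d : ℕ} (hd : Nat.card S = d) [NeZero d] (x y : ZMod d) :
    ∑ E : S, ZMod.stdAddChar ((E : ZMod N) * ((y.val : ZMod N) - (x.val : ZMod N)))
      = if x = y then (d : ℂ) else 0 := by
  set z : ZMod N := (y.val : ZMod N) - (x.val : ZMod N) with hz
  let φ : AddChar S ℂ := (AddChar.mulShift ZMod.stdAddChar z).compAddMonoidHom S.subtype
  have hφ : ∀ E : S, ZMod.stdAddChar ((E : ZMod N) * z) = φ E := fun E ↦ by
    simp [φ, AddChar.mulShift_apply, mul_comm]
  simp_rw [hφ]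
  split_ifs with hxy
  · have : z = 0 := by simp [hz, hxy]
    simp_rw [← hφ, this]
    simp [← hd]
  · refine AddChar.sum_eq_zero_of_ne_one fun h ↦ hxy ?_
    obtain ⟨g, hg⟩ := IsAddCyclic.exists_zsmul_surjective (G := S)
    have hgo : addOrderOf g = d := by
      rw [← hd]
      exact addOrderOf_eq_card_of_forall_mem_zmultiples hg
    have h1 : ZMod.stdAddChar ((g : ZMod N) * z) = 1 := by rw [hφ, h]; rfl
    have h2 : (g : ZMod N) * z = 0 :=
      ZMod.injective_stdAddChar (h1.trans (AddChar.map_zero_eq_one _).symm)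
    have h3 : y.val • g = x.val • g := by
      apply Subtype.ext
      rw [hz, mul_sub, sub_eq_zero] at h2
      simpa [mul_comm] using h2
    have h4 := nsmul_eq_nsmul_iff_modEq.mp h3
    rw [hgo, Nat.ModEq, Nat.mod_eq_of_lt (ZMod.val_lt y), Nat.mod_eq_of_lt (ZMod.val_lt x)] at h4
    exact (ZMod.val_injective d h4).symm

/-- A non-degenerate spectral resolution is given by an orthonormal basis of eigenvectors
indexed by the spectrum. -/
lemma exists_orthonormalBasis_spectrum {ι : Type*} [Fintype ι] {H : Type*}
    [NormedAddCommGroup H] [InnerProductSpace ℂ H] [FiniteDimensional ℂ H]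
    {P : ι → (H →L[ℂ] H)} (hPsa : ∀ E, IsSelfAdjoint (P E))
    (hPidem : ∀ E, P E ∘L P E = P E) (hPorth : ∀ E E', E ≠ E' → P E ∘L P E' = 0)
    (hPsum : (∑ E, P E) = 1)
    (hnondeg : ∀ E, Module.finrank ℂ (LinearMap.range ((P E : H →L[ℂ] H) : H →ₗ[ℂ] H)) ≤ 1)
    {s : Set ι} [Fintype s] (hs : s = {E | P E ≠ 0}) :
    ∃ e : OrthonormalBasis s ℂ H, ∀ E : s, P E (e E) = e E := by
  subst hs
  have hex : ∀ E : {E | P E ≠ 0}, ∃ v : H, ‖v‖ = 1 ∧ P E v = v := by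
    rintro ⟨E, hE⟩
    obtain ⟨w, hw⟩ : ∃ w, P E w ≠ 0 := by
      by_contra! h
      exact hE (ContinuousLinearMap.ext h)
    refine ⟨((‖P E w‖⁻¹ : ℝ) : ℂ) • P E w, ?_, ?_⟩
    · simp [norm_smul, hw]
    · rw [map_smul]
      congr 1
      exact DFunLike.congr_fun (hPidem E) w
  choose e he1 he2 using hex
  have hon : Orthonormal ℂ e := by
    refine ⟨he1, fun E F hEF ↦ ?_⟩
    change ⟪e E, e F⟫_ℂ = 0
    rw [← he2 E, ← he2 F, (hPsa E).isSymmetric.apply_clm]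
    have h := DFunLike.congr_fun (hPorth E F fun h ↦ hEF (Subtype.ext h)) (e F)
    rw [ContinuousLinearMap.comp_apply] at h
    rw [h]
    simp
  have hsp : ⊤ ≤ Submodule.span ℂ (Set.range e) := by
    intro v _
    have hv : v = ∑ E, P E v := by
      rw [← _root_.sum_apply, hPsum]
      rfl
    rw [hv]
    refine Submodule.sum_mem _ fun E _ ↦ ?_
    by_cases hE : P E = 0
    · simp [hE]
    · let u : LinearMap.range ((P E : H →L[ℂ] H) : H →ₗ[ℂ] H) := ⟨e ⟨E, hE⟩, e ⟨E, hE⟩, he2 ⟨E, hE⟩⟩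
      have hu : u ≠ 0 := fun h ↦ hon.ne_zero ⟨E, hE⟩ (congrArg Subtype.val h)
      have h1 := le_antisymm (hnondeg E) (Module.finrank_pos_iff_exists_ne_zero.mpr ⟨u, hu⟩)
      obtain ⟨c, hc⟩ := exists_smul_eq_of_finrank_eq_one h1 hu ⟨P E v, v, rfl⟩
      have hc' : c • e ⟨E, hE⟩ = P E v := congrArg Subtype.val hc
      rw [← hc']
      exact Submodule.smul_mem _ _ (Submodule.subset_span ⟨_, rfl⟩)
  exact ⟨OrthonormalBasis.mk hon hsp, fun E ↦ by simpa using he2 E⟩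

/-- The Fourier transform of an energy eigenbasis indexed by a subgroup is a time basis. -/
lemma exists_timeBasis {N : ℕ} [NeZero N] {H : Type*} [NormedAddCommGroup H]
    [InnerProductSpace ℂ H] [FiniteDimensional ℂ H] {U : ZMod N → (H →L[ℂ] H)}
    (S : AddSubgroup (ZMod N)) [Fintype S] (e : OrthonormalBasis S ℂ H)
    (hUe : ∀ (t : ZMod N) (E : S), U t (e E) = chi N E t • e E)
    {d : ℕ} (hd : Nat.card S = d) [NeZero d] (hdvd : d ∣ N) :
    ∃ b : OrthonormalBasis (ZMod d) ℂ H,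
      ∀ t x, U t (b x) = b (x + ZMod.castHom hdvd (ZMod d) t) := by
  have hd0 : (d : ℂ) ≠ 0 := Nat.cast_ne_zero.mpr (NeZero.ne d)
  let r : ℂ := ((Real.sqrt d)⁻¹ : ℝ)
  have hr : r * r * d = 1 := by
    have : r * r = (d : ℂ)⁻¹ := by
      simp only [r]
      rw [← Complex.ofReal_mul, ← mul_inv, Real.mul_self_sqrt (Nat.cast_nonneg d)]
      simp
    rw [this, inv_mul_cancel₀ hd0]
  let c : ZMod d → S → ℂ := fun x E ↦ ZMod.stdAddChar ((E : ZMod N) * (x.val : ZMod N))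
  let b : ZMod d → H := fun x ↦ r • ∑ E : S, c x E • e E
  have hb : Orthonormal ℂ b := by
    rw [orthonormal_iff_ite]
    intro x y
    have hc : ∀ E, (starRingEnd ℂ) (c x E) * c y E
        = ZMod.stdAddChar ((E : ZMod N) * ((y.val : ZMod N) - (x.val : ZMod N))) := fun E ↦ by
      simp only [c]
      rw [← AddChar.map_neg_eq_conj, ← AddChar.map_add_eq_mul]
      congr 1
      ring
    have hrr : (starRingEnd ℂ) r = r := Complex.conj_ofReal _
    simp only [b, inner_smul_left, inner_smul_right, e.orthonormal.inner_sum, hc, hrr,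
      sum_addSubgroup_stdAddChar N S hd x y]
    split_ifs
    · rw [← mul_assoc, hr]
    · simp
  have hcard : Fintype.card (ZMod d) = Module.finrank ℂ H := by
    rw [Module.finrank_eq_card_basis e.toBasis, ZMod.card, ← hd, Nat.card_eq_fintype_card]
  refine ⟨OrthonormalBasis.mk hb (hb.linearIndependent.span_eq_top_of_card_eq_finrank' hcard).ge,
    fun t x ↦ ?_⟩
  simp only [OrthonormalBasis.coe_mk, b, map_smul, map_sum, hUe, smul_smul]
  congr 1
  refine Finset.sum_congr rfl fun E _ ↦ ?_
  congr 1
  simp only [c]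
  rw [chi_eq_stdAddChar, ← AddChar.map_add_eq_mul, ← mul_add]
  congr 1
  have hmod : x.val + t.val ≡ (x + ZMod.castHom hdvd (ZMod d) t).val [MOD d] := by
    rw [← ZMod.natCast_eq_natCast_iff]
    have ht : ((t.val : ℕ) : ZMod d) = ZMod.castHom hdvd (ZMod d) t := by
      rw [← map_natCast (ZMod.castHom hdvd (ZMod d)), ZMod.natCast_zmod_val]
    rw [Nat.cast_add, ht, ZMod.natCast_zmod_val, ZMod.natCast_zmod_val]
  have hsm : (x.val + t.val) • E = (x + ZMod.castHom hdvd (ZMod d) t).val • E :=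
    nsmul_eq_nsmul_iff_modEq.mpr (hmod.of_dvd (hd ▸ addOrderOf_dvd_natCard E))
  have h := congrArg (Subtype.val : S → ZMod N) hsm
  simpa [mul_comm, mul_add, add_mul] using h

/-- Existence of an internal time observable: a non-degenerate quantum dynamical system
admits an orthonormal time basis, indexed by a quotient clock `ZMod d` with `d ∣ N` and on
which the dynamic acts by translation, if and only if its spectrum (the set of occupied
energy levels) is a subgroup of the Pontryagin dual `ZMod N`. -/
theorem internal_time_observable
    (N : ℕ) [NeZero N] {H : Type*} [NormedAddCommGroup H] [InnerProductSpace ℂ H]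
    [FiniteDimensional ℂ H]
    (U : ZMod N → (H →L[ℂ] H))
    (hU0 : U 0 = 1)
    (hUadd : ∀ s t : ZMod N, U (s + t) = U s ∘L U t)
    (hUunitary : ∀ (t : ZMod N) (v w : H), ⟪U t v, U t w⟫_ℂ = ⟪v, w⟫_ℂ)
    (P : ZMod N → (H →L[ℂ] H))
    (hPsa : ∀ E, IsSelfAdjoint (P E))
    (hPidem : ∀ E, P E ∘L P E = P E)
    (hPorth : ∀ E E', E ≠ E' → P E ∘L P E' = 0)
    (hPsum : (∑ E : ZMod N, P E) = 1)
    (hUP : ∀ t : ZMod N, U t = ∑ E : ZMod N, chi N E t • P E)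
    (hnondeg : ∀ E : ZMod N,
      Module.finrank ℂ (LinearMap.range ((P E : H →L[ℂ] H) : H →ₗ[ℂ] H)) ≤ 1) :
    (∃ (d : ℕ) (hd : 0 < d) (hdvd : d ∣ N),
        letI : NeZero d := ⟨hd.ne'⟩
        ∃ b : OrthonormalBasis (ZMod d) ℂ H,
          ∀ (t : ZMod N) (x : ZMod d),
            U t (b x) = b (x + ZMod.castHom hdvd (ZMod d) t))
      ↔ ∃ S : AddSubgroup (ZMod N), (S : Set (ZMod N)) = {E : ZMod N | P E ≠ 0} := by
  constructor
  · rintro ⟨d, hd, hdvd, b, hb⟩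
    have : NeZero d := ⟨hd.ne'⟩
    refine ⟨(AddMonoidHom.mulRight (d : ZMod N)).ker, ?_⟩
    ext E
    exact (ne_zero_iff_of_timeBasis hPidem hPorth hUP hdvd b hb E).symm
  · rintro ⟨S, hS⟩
    have : Fintype S := Fintype.ofFinite S
    obtain ⟨e, he⟩ := exists_orthonormalBasis_spectrum hPsa hPidem hPorth hPsum hnondeg hS
    have hdvd : Nat.card S ∣ N := by
      simpa using S.card_addSubgroup_dvd_card
    refine ⟨Nat.card S, Nat.card_pos, hdvd, ?_⟩
    have : NeZero (Nat.card S) := ⟨Nat.card_pos.ne'⟩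
    refine exists_timeBasis S e (fun t E ↦ ?_) rfl hdvd
    rw [hUP, _root_.sum_apply, Finset.sum_eq_single (E : ZMod N)]
    · rw [_root_.smul_apply, he]
    · intro F _ hF
      have h := DFunLike.congr_fun (hPorth F E hF) (e E)
      rw [ContinuousLinearMap.comp_apply, he] at h
      rw [_root_.smul_apply, h]
      simp
    · simp
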